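/- Let T > 0, β > 1/3 and 1 ≤ p ≤ ∞. Let (v, θ) be a weak solution of the inviscid Boussinesq system on [0,T] with smooth initial data (v_in, θ_in) such that v, θ ∈ C([0,T]; C^β(T^3)). Then the L^p norm of the temperature is conserved: ‖θ(·,t)‖_{L^p(T^3)} = ‖θ_in‖_{L^p(T^3)} for every t ∈ [0,T]. -/

import Mathlib

open MeasureTheory Set Real Filter
open scoped ENNReal NNReal BigOperators

noncomputable section

abbrev V3 := Fin 3 → ℝ

/-- Fundamental domain of the torus `T³ = ℝ³/ℤ³`. -/
def cube3 : Set V3 := Set.univ.pi fun _ => Set.Ico (0:ℝ) 1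

/-- The measure on the torus, realized as Lebesgue measure on the fundamental domain. -/
def muT : Measure V3 := volume.restrict cube3

/-- `ℤ³`-periodicity of a function on `ℝ³`. -/
def Per {α : Type*} (f : V3 → α) : Prop :=
  ∀ (x : V3) (k : Fin 3 → ℤ), f (x + (fun i => (k i : ℝ))) = f x

/-- The partial derivative `∂ᵢ g` at `x`. -/
def pd (g : V3 → ℝ) (i : Fin 3) (x : V3) : ℝ := fderiv ℝ g x (Pi.single i 1)

/-- Divergence of a vector field. -/
def divg (u : V3 → V3) (x : V3) : ℝ := ∑ i, pd (fun y => u y i) i x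

/-- Euclidean norm on `ℝ³`. -/
def nE (x : V3) : ℝ := Real.sqrt (∑ i, x i ^ 2)

/-- Divergence-free smooth periodic test vector fields supported in `[0,T)` in time. -/
def TestV (T : ℝ) (φ : ℝ → V3 → V3) : Prop :=
  ContDiff ℝ (⊤ : ℕ∞) (fun q : ℝ × V3 => φ q.1 q.2) ∧ (∀ t, Per (φ t)) ∧
  (∃ T' : ℝ, T' < T ∧ ∀ t x, T' ≤ t → φ t x = 0) ∧ (∀ t x, divg (φ t) x = 0)

/-- Smooth periodic scalar test functions supported in `[0,T)` in time. -/
def TestS (T : ℝ) (ψ : ℝ → V3 → ℝ) : Prop :=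
  ContDiff ℝ (⊤ : ℕ∞) (fun q : ℝ × V3 => ψ q.1 q.2) ∧ (∀ t, Per (ψ t)) ∧
  (∃ T' : ℝ, T' < T ∧ ∀ t x, T' ≤ t → ψ t x = 0)

/-- Weak solution of the inviscid Boussinesq system on `[0,T]` with initial data
`(vin, θin)`: a continuous pair, divergence-free for a.e. time, satisfying the weak
formulations of the momentum and temperature equations. -/
structure IsWeakBoussinesq (T : ℝ) (vin : V3 → V3) (θin : V3 → ℝ)
    (v : ℝ → V3 → V3) (θ : ℝ → V3 → ℝ) : Prop where
  contv : ContinuousOn (fun q : ℝ × V3 => v q.1 q.2) (Icc 0 T ×ˢ (univ : Set V3))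
  contθ : ContinuousOn (fun q : ℝ × V3 => θ q.1 q.2) (Icc 0 T ×ˢ (univ : Set V3))
  perv : ∀ t, Per (v t)
  perθ : ∀ t, Per (θ t)
  divfree : ∀ᵐ t ∂(volume.restrict (Icc (0:ℝ) T)),
      ∀ ψ : V3 → ℝ, ContDiff ℝ (⊤ : ℕ∞) ψ → Per ψ →
        (∫ x in cube3, ∑ i, v t x i * pd ψ i x) = 0
  momentum : ∀ φ : ℝ → V3 → V3, TestV T φ →
      (-(∫ x in cube3, ∑ i, vin x i * φ 0 x i))
          - (∫ s in Icc (0:ℝ) T, ∫ x in cube3, ∑ i, deriv (fun r => φ r x i) s * v s x i)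
        = ∫ s in Icc (0:ℝ) T, ∫ x in cube3,
            ((∑ i, ∑ j, pd (fun y => φ s y i) j x * v s x i * v s x j) + θ s x * φ s x 2)
  transport : ∀ ψ : ℝ → V3 → ℝ, TestS T ψ →
      (-(∫ x in cube3, θin x * ψ 0 x))
          - (∫ s in Icc (0:ℝ) T, ∫ x in cube3, deriv (fun r => ψ r x) s * θ s x)
        = ∫ s in Icc (0:ℝ) T, ∫ x in cube3, (∑ i, v s x i * pd (ψ s) i x) * θ s x

/-- Smooth, periodic, (distributionally) divergence-free initial data. -/
def SmoothData (vin : V3 → V3) (θin : V3 → ℝ) : Prop :=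
  ContDiff ℝ (⊤ : ℕ∞) vin ∧ ContDiff ℝ (⊤ : ℕ∞) θin ∧ Per vin ∧ Per θin ∧
  ∀ ψ : V3 → ℝ, ContDiff ℝ (⊤ : ℕ∞) ψ → Per ψ →
    (∫ x in cube3, ∑ i, vin x i * pd ψ i x) = 0

section Conservation

open scoped Topology ContDiff

theorem muT_eq_Icc : muT = volume.restrict (Icc (0 : V3) 1) := by
  have h : cube3 =ᵐ[volume] Icc (0 : V3) 1 :=
    Measure.univ_pi_Ico_ae_eq_Icc (μ := fun _ : Fin 3 => (volume : Measure ℝ))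
      (f := (0 : V3)) (g := 1)
  exact Measure.restrict_congr_set h

instance : IsProbabilityMeasure muT := ⟨by
  rw [muT_eq_Icc, Measure.restrict_apply_univ, Real.volume_Icc_pi]
  simp⟩

/-- The inclusion of `ℤ³` in `ℝ³`. -/
def latticeHom : (Fin 3 → ℤ) →+ V3 where
  toFun k i := k i
  map_zero' := by ext; simp
  map_add' _ _ := by ext; simp

/-- The half-open unit box with lower corner `a`. -/
def unitBox (a : V3) : Set V3 := Set.univ.pi fun i => Set.Ico (a i) (a i + 1)

theorem unitBox_zero : unitBox 0 = cube3 := by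
  simp [unitBox, cube3]

theorem measurableSet_unitBox (a : V3) : MeasurableSet (unitBox a) :=
  MeasurableSet.univ_pi fun _ => measurableSet_Ico

theorem isAddFundamentalDomain_unitBox (a : V3) :
    IsAddFundamentalDomain latticeHom.range (unitBox a) (volume : Measure V3) := by
  refine IsAddFundamentalDomain.mk' (measurableSet_unitBox a).nullMeasurableSet fun x => ?_
  have h : ∀ i, ∃! m : ℤ, x i + m • (1 : ℝ) ∈ Ico (a i) (a i + 1) := fun i =>
    existsUnique_add_zsmul_mem_Ico one_pos (x i) (a i)
  choose m hm hm' using h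
  refine ⟨⟨latticeHom m, m, rfl⟩, ?_, ?_⟩
  · intro i _
    change (m i : ℝ) + x i ∈ _
    simpa [add_comm] using hm i
  · rintro ⟨_, k, rfl⟩ hk
    have : k = m := by
      ext i
      apply hm' i
      have h : (k i : ℝ) + x i ∈ _ := hk i trivial
      simpa [add_comm] using h
    simp [this]

theorem Per.setIntegral_unitBox {F : V3 → ℝ} (hF : Per F) (a : V3) :
    ∫ y in unitBox a, F y = ∫ y, F y ∂muT := by
  have : Countable latticeHom.range := by
    have := (Set.countable_range latticeHom)
    exact this.to_subtype
  rw [muT, ← unitBox_zero]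
  refine (isAddFundamentalDomain_unitBox a).setIntegral_eq (isAddFundamentalDomain_unitBox 0) ?_
  rintro ⟨_, k, rfl⟩ x
  change F ((fun i => (k i : ℝ)) + x) = F x
  rw [add_comm, hF x k]

/-- Lebesgue measure on the centred unit box. -/
def muQ : Measure V3 := volume.restrict (unitBox fun _ => -(1 / 2))

theorem Per.integral_add_left {F : V3 → ℝ} (hF : Per F) (x : V3) :
    ∫ z, F (x + z) ∂muQ = ∫ y, F y ∂muT := by
  rw [← hF.setIntegral_unitBox (x + fun _ => -(1 / 2)), muQ,
    ← integral_indicator (measurableSet_unitBox _), ← integral_indicator (measurableSet_unitBox _),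
    ← integral_add_left_eq_self ((unitBox (x + fun _ => -(1 / 2))).indicator _) x]
  congr 1 with z
  have : x + z ∈ unitBox (x + fun _ => -(1 / 2)) ↔ z ∈ unitBox fun _ => -(1 / 2) := by
    simp [unitBox, add_assoc]
  by_cases h : z ∈ unitBox fun _ => -(1 / 2)
  · exact (indicator_of_mem h _).trans (indicator_of_mem (this.2 h) _).symm
  · exact (indicator_of_notMem h _).trans (indicator_of_notMem (fun h' => h (this.1 h')) _).symm

instance : IsProbabilityMeasure muQ := ⟨by
  rw [muQ, Measure.restrict_apply_univ, unitBox, Real.volume_pi_Ico]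
  simp⟩

theorem integrable_muT {E : Type*} [NormedAddCommGroup E] {F : V3 → E} (hF : Continuous F) :
    Integrable F muT := by
  rw [muT_eq_Icc]
  exact hF.continuousOn.integrableOn_compact isCompact_Icc

theorem integrable_muQ {E : Type*} [NormedAddCommGroup E] {F : V3 → E} (hF : Continuous F) :
    Integrable F muQ := by
  refine (hF.continuousOn.integrableOn_compact
    (isCompact_Icc (a := fun _ => -(1 / 2)) (b := fun _ => 1))).mono_set ?_
  intro z hz
  refine ⟨fun i => (hz i trivial).1, fun i => (hz i trivial).2.le.trans ?_⟩
  norm_num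

theorem continuous_integral_muT {X E : Type*} [TopologicalSpace X] [LocallyCompactSpace X]
    [FirstCountableTopology X] [NormedAddCommGroup E] [NormedSpace ℝ E]
    {f : X → V3 → E} (hf : Continuous (Function.uncurry f)) :
    Continuous fun x => ∫ y, f x y ∂muT := by
  rw [muT_eq_Icc]
  exact continuous_parametric_integral_of_continuous hf isCompact_Icc

theorem Per.integral_pd_eq_zero {F : Fin 3 → V3 → ℝ} {F' : Fin 3 → V3 → V3 →L[ℝ] ℝ}
    (hF : ∀ i, Per (F i)) (hd : ∀ i x, HasFDerivAt (F i) (F' i x) x)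
    (hc : Continuous fun x => ∑ i, F' i x (Pi.single i 1)) :
    ∫ x, ∑ i, F' i x (Pi.single i 1) ∂muT = 0 := by
  rw [muT_eq_Icc, integral_divergence_of_hasFDerivAt_off_countable' (0 : V3) 1 zero_le_one F F' ∅
    countable_empty (fun i => (continuous_iff_continuousAt.2 fun x =>
      (hd i x).continuousAt).continuousOn) (fun x _ i => hd i x)
    (hc.continuousOn.integrableOn_compact isCompact_Icc)]
  refine Finset.sum_eq_zero fun i _ => ?_
  rw [sub_eq_zero]
  congr 1 with x
  have := hF i (i.insertNth ((0 : V3) i) x) (Pi.single i 1)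
  rw [← this]
  congr 1
  ext j
  refine Fin.succAboveCases i ?_ (fun j => ?_) j <;> simp

/-- `K` is a smooth `ℤ³`-periodic mollifier at scale `ε`, with `L¹` gradient bound `C / ε`. -/
structure IsMollifier (K : V3 → ℝ) (ε C : ℝ) : Prop where
  contDiff : ContDiff ℝ ∞ K
  per : Per K
  nonneg : ∀ z, 0 ≤ K z
  integral_eq_one : ∫ z, K z ∂muQ = 1
  norm_le_of_ne_zero : ∀ z ∈ unitBox fun _ => -(1 / 2), K z ≠ 0 → ‖z‖ ≤ ε
  norm_le_of_pd_ne_zero : ∀ i, ∀ z ∈ unitBox fun _ => -(1 / 2), pd K i z ≠ 0 → ‖z‖ ≤ ε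
  integral_abs_pd_le : ∀ i, ∫ z, |pd K i z| ∂muQ ≤ C / ε

/-- A smooth periodic function on `ℝ³` comparable with the squared distance to `ℤ³`. -/
def sinSq (z : V3) : ℝ := ∑ i, sin (π * z i) ^ 2

theorem contDiff_sinSq : ContDiff ℝ ∞ sinSq := by
  unfold sinSq
  fun_prop

theorem sinSq_nonneg (z : V3) : 0 ≤ sinSq z := Finset.sum_nonneg fun _ _ => sq_nonneg _

theorem sq_sin_le_sinSq (z : V3) (i : Fin 3) : sin (π * z i) ^ 2 ≤ sinSq z :=
  Finset.single_le_sum (f := fun i => sin (π * z i) ^ 2) (fun _ _ => sq_nonneg _)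
    (Finset.mem_univ i)

theorem per_sinSq : Per sinSq := by
  intro x k
  refine Finset.sum_congr rfl fun i _ => ?_
  have : π * (x + fun i => (k i : ℝ)) i = π * x i + k i * π := by simp; ring
  rw [this, Real.sin_add_int_mul_pi, mul_pow, ← zpow_natCast, ← zpow_mul, mul_comm (k i),
    zpow_mul]
  simp

theorem hasFDerivAt_sinSq (z : V3) :
    HasFDerivAt sinSq (∑ i, (2 * sin (π * z i) * (cos (π * z i) * π)) •
      (ContinuousLinearMap.proj i : V3 →L[ℝ] ℝ)) z := by
  unfold sinSq
  refine HasFDerivAt.fun_sum fun i _ => ?_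
  have h1 : HasFDerivAt (fun z : V3 => z i) (ContinuousLinearMap.proj i : V3 →L[ℝ] ℝ) z :=
    (ContinuousLinearMap.proj i : V3 →L[ℝ] ℝ).hasFDerivAt
  have h2 : HasDerivAt (fun x => sin (π * x) ^ 2) (2 * sin (π * z i) * (cos (π * z i) * π))
      (z i) := by
    simpa using (((hasDerivAt_id (z i)).const_mul π).sin.fun_pow 2)
  exact h2.comp_hasFDerivAt z h1

theorem norm_le_of_sinSq_le {z : V3} (hz : z ∈ unitBox fun _ => -(1 / 2)) {ε : ℝ} (hε : 0 < ε)
    (h : sinSq z ≤ 2 * ε ^ 2) : ‖z‖ ≤ ε := by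
  rw [pi_norm_le_iff_of_nonneg hε.le]
  intro i
  have hi := hz i trivial
  have hi1 : |z i| ≤ 1 / 2 := abs_le.2 ⟨hi.1, by linarith [hi.2]⟩
  have h1 := Real.mul_abs_le_abs_sin (x := π * z i) (by
    rw [abs_mul, abs_of_pos pi_pos]; nlinarith [pi_pos])
  rw [abs_mul, abs_of_pos pi_pos, ← mul_assoc, div_mul_cancel₀ _ pi_pos.ne'] at h1
  have h2 := sq_sin_le_sinSq z i
  rw [Real.norm_eq_abs]
  refine abs_le_of_sq_le_sq ?_ hε.le
  rw [← sq_abs (sin _)] at h2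
  rw [← sq_abs]
  nlinarith [abs_nonneg (z i)]

theorem sinSq_le_of_norm_le {z : V3} {r : ℝ} (h : ‖z‖ ≤ r) : sinSq z ≤ 48 * r ^ 2 := by
  have h1 : ∀ i : Fin 3, sin (π * z i) ^ 2 ≤ 16 * r ^ 2 := by
    intro i
    have h2 : |z i| ≤ r := (norm_le_pi_norm z i).trans h
    have h3 : |sin (π * z i)| ≤ 4 * r := by
      refine Real.abs_sin_le_abs.trans ?_
      rw [abs_mul, abs_of_pos pi_pos]
      exact mul_le_mul pi_le_four h2 (abs_nonneg _) (by norm_num)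
    rw [← sq_abs]
    nlinarith [abs_nonneg (sin (π * z i))]
  calc sinSq z ≤ ∑ _i : Fin 3, 16 * r ^ 2 := Finset.sum_le_sum fun i _ => h1 i
    _ = 48 * r ^ 2 := by simp; ring

theorem exists_isMollifier :
    ∃ C, ∀ ε : ℝ, 0 < ε → ε ≤ 1 / 2 → ∃ K, IsMollifier K ε C := by
  let b : ContDiffBump (0 : ℝ) := ⟨1, 2, one_pos, one_lt_two⟩
  have hb : ContDiff ℝ ∞ b := b.contDiff
  have hb' : Continuous (deriv b) := hb.continuous_deriv (by simp)
  obtain ⟨B, hB⟩ := hb'.bounded_above_of_compact_support b.hasCompactSupport.deriv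
  have hB0 : 0 ≤ B := (norm_nonneg _).trans (hB 0)
  refine ⟨2048 * π * B, fun ε hε hε2 => ?_⟩
  set P : V3 → ℝ := fun z => b (sinSq z / ε ^ 2) with hP
  have hPs : ContDiff ℝ ∞ P := hb.comp (contDiff_sinSq.div_const _)
  have hP0 : ∀ z, 0 ≤ P z := fun z => b.nonneg
  have hPd : ∀ i z, pd P i z =
      deriv b (sinSq z / ε ^ 2) * (2 * sin (π * z i) * (cos (π * z i) * π) / ε ^ 2) := by
    intro i z
    have h1 := ((hb.differentiable (by simp)).differentiableAt
      (x := sinSq z / ε ^ 2)).hasDerivAt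
    have h2 := h1.comp_hasFDerivAt z ((hasFDerivAt_sinSq z).mul_const ((ε ^ 2)⁻¹))
    have h3 : HasFDerivAt P _ z := h2
    rw [pd, h3.fderiv]
    simp only [div_eq_mul_inv, smul_apply, FunLike.coe_sum, Finset.sum_apply,
      ContinuousLinearMap.proj_apply, Pi.single_apply, smul_eq_mul, mul_ite, mul_one, mul_zero,
      Finset.sum_ite_eq', Finset.mem_univ, if_true]
    ring
  have hle : ∀ z, |sinSq z / ε ^ 2| ≤ 2 → sinSq z ≤ 2 * ε ^ 2 := by
    intro z h
    have := (le_abs_self _).trans h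
    rwa [div_le_iff₀ (by positivity)] at this
  have hsupp : ∀ z ∈ unitBox fun _ => -(1 / 2), P z ≠ 0 → ‖z‖ ≤ ε := by
    intro z hz h
    refine norm_le_of_sinSq_le hz hε (hle z ?_)
    have : sinSq z / ε ^ 2 ∈ Function.support b := h
    rw [b.support_eq] at this
    exact (mem_ball_zero_iff.1 this).le
  have hd2 : ∀ i z, pd P i z ≠ 0 → sinSq z ≤ 2 * ε ^ 2 := by
    intro i z h
    refine hle z ?_
    rw [hPd] at h
    have := support_deriv_subset (left_ne_zero_of_mul h)
    rw [b.tsupport_eq] at this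
    exact mem_closedBall_zero_iff.1 this
  have hpd : ∀ i z, |pd P i z| ≤ 4 * π * B / ε := by
    intro i z
    by_cases h0 : pd P i z = 0
    · rw [h0, abs_zero]; positivity
    have h1 : |sin (π * z i)| ≤ 2 * ε := by
      refine abs_le_of_sq_le_sq ?_ (by positivity) 
      nlinarith [sq_sin_le_sinSq z i, hd2 i z h0, sq_nonneg ε]
    rw [hPd, abs_mul, abs_div, abs_mul, abs_mul, abs_mul, abs_of_pos pi_pos, abs_two,
      abs_of_nonneg (sq_nonneg ε)]
    calc _ ≤ B * (2 * (2 * ε) * (1 * π) / ε ^ 2) := by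
          gcongr
          · exact hB _
          · exact abs_cos_le_one _
      _ = _ := by field_simp; ring
  set c := ∫ z, P z ∂muQ with hc
  have hclow : (ε / 4) ^ 3 ≤ c := by
    have h1 : muQ.real (Metric.closedBall 0 (ε / 8)) = (ε / 4) ^ 3 := by
      rw [muQ, measureReal_restrict_apply Metric.isClosed_closedBall.measurableSet,
        inter_eq_self_of_subset_left, measureReal_def, Real.volume_pi_closedBall _ (by positivity)]
      · rw [ENNReal.toReal_ofReal (by positivity)]
        simp; ring
      · intro z hz i _
        have h2 := (norm_le_pi_norm z i).trans (mem_closedBall_zero_iff.1 hz)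
        have h3 := abs_le.1 h2
        constructor <;> linarith [h3.1, h3.2]
    rw [← h1, ← integral_indicator_one Metric.isClosed_closedBall.measurableSet, hc]
    refine integral_mono ((integrable_const 1).indicator
      Metric.isClosed_closedBall.measurableSet) (integrable_muQ hPs.continuous) fun z => ?_
    by_cases hz : z ∈ Metric.closedBall (0 : V3) (ε / 8)
    · have h2 := sinSq_le_of_norm_le (mem_closedBall_zero_iff.1 hz)
      have h3 : P z = 1 := b.one_of_mem_closedBall (by
        rw [mem_closedBall_zero_iff, Real.norm_eq_abs,
          abs_of_nonneg (div_nonneg (sinSq_nonneg z) (sq_nonneg ε))]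
        change _ ≤ (1 : ℝ)
        rw [div_le_one (by positivity)]
        nlinarith [sq_nonneg ε])
      rw [indicator_of_mem hz, h3]
      rfl
    · rw [indicator_of_notMem hz]
      exact hP0 z
  have hc0 : 0 < c := lt_of_lt_of_le (by positivity) hclow
  have hpdK : ∀ i z, pd (fun z => P z / c) i z = pd P i z / c := by
    intro i z
    have h := ((hPs.differentiable (by simp)) z).hasFDerivAt.mul_const c⁻¹
    simp only [pd, div_eq_mul_inv, h.fderiv]
    simp [mul_comm]
  have hpdne : ∀ i, ∀ z ∈ unitBox fun _ => -(1 / 2), pd P i z ≠ 0 → ‖z‖ ≤ ε := fun i z hz h =>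
    norm_le_of_sinSq_le hz hε (hd2 i z h)
  refine ⟨fun z => P z / c, hPs.div_const c, fun x k => ?_, fun z => div_nonneg (hP0 z) hc0.le, ?_,
    fun z hz h => hsupp z hz fun h' => h (by simp [h']), fun i z hz h => hpdne i z hz fun h' => h ?_,
    fun i => ?_⟩
  · simp only [hP, per_sinSq x k]
  · rw [integral_div, div_self hc0.ne']
  · rw [hpdK, h', zero_div]
  simp only [hpdK, abs_div, abs_of_pos hc0]
  rw [integral_div, div_le_iff₀ hc0]
  have hball : muQ.real (Metric.closedBall 0 ε) ≤ (2 * ε) ^ 3 := by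
    rw [muQ, measureReal_restrict_apply Metric.isClosed_closedBall.measurableSet]
    refine (measureReal_mono inter_subset_left (measure_closedBall_lt_top).ne).trans ?_
    rw [measureReal_def, Real.volume_pi_closedBall _ hε.le, ENNReal.toReal_ofReal (by positivity)]
    simp
  have hint : ∫ z, |pd P i z| ∂muQ ≤ 4 * π * B / ε * (2 * ε) ^ 3 := by
    calc ∫ z, |pd P i z| ∂muQ
        ≤ ∫ z, (Metric.closedBall (0 : V3) ε).indicator (fun _ => 4 * π * B / ε) z ∂muQ := by
          refine integral_mono_of_nonneg (Eventually.of_forall fun _ => abs_nonneg _)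
            ((integrable_const _).indicator Metric.isClosed_closedBall.measurableSet) ?_
          filter_upwards [ae_restrict_mem (measurableSet_unitBox _)] with z hz
          by_cases h0 : pd P i z = 0
          · rw [h0, abs_zero]
            exact indicator_nonneg (fun _ _ => by positivity) z
          · rw [indicator_of_mem (mem_closedBall_zero_iff.2 (hpdne i z hz h0))]
            exact hpd i z
      _ = muQ.real (Metric.closedBall 0 ε) * (4 * π * B / ε) := by
          rw [integral_indicator_const _ Metric.isClosed_closedBall.measurableSet, smul_eq_mul]
      _ ≤ _ := by
          rw [mul_comm]
          gcongr
  calc _ ≤ 4 * π * B / ε * (2 * ε) ^ 3 := hint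
    _ = 2048 * π * B / ε * (ε / 4) ^ 3 := by ring
    _ ≤ _ := by gcongr

/-- Mollification of a periodic function `g` by a kernel `K`. -/
def mollify (K g : V3 → ℝ) (x : V3) : ℝ := ∫ y, K (y - x) * g y ∂muT

theorem Per.neg_lattice {α : Type*} {f : V3 → α} (hf : Per f) (x : V3) (k : Fin 3 → ℤ) :
    f (x - fun i => (k i : ℝ)) = f x := by
  simpa using (hf (x - fun i => (k i : ℝ)) k).symm

theorem per_mollify {K : V3 → ℝ} (hK : Per K) (g : V3 → ℝ) : Per (mollify K g) := by
  intro x k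
  simp only [mollify, ← sub_sub, hK.neg_lattice]

theorem Per.mul {f g : V3 → ℝ} (hf : Per f) (hg : Per g) : Per fun x => f x * g x :=
  fun x k => by simp only [hf x k, hg x k]

theorem Per.comp {α β : Type*} {f : V3 → α} (hf : Per f) (F : α → β) : Per fun x => F (f x) :=
  fun x k => by simp only [hf x k]

theorem Per.comp_sub {α : Type*} {f : V3 → α} (hf : Per f) (a : V3) : Per fun y => f (y - a) :=
  fun x k => by simp only [add_sub_right_comm, hf _ k]

theorem Per.pd {g : V3 → ℝ} (hg : Per g) (i : Fin 3) : Per (pd g i) := by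
  intro x k
  have h : (fun y => g (y + fun i => (k i : ℝ))) = g := funext fun y => hg y k
  simp only [_root_.pd]
  rw [← fderiv_comp_add_right, h]

theorem mollify_eq {K g : V3 → ℝ} (hK : Per K) (hg : Per g) (x : V3) :
    mollify K g x = ∫ z, K z * g (x + z) ∂muQ := by
  rw [mollify, ← ((hK.comp_sub x).mul hg).integral_add_left x]
  simp

theorem continuous_mollify {X : Type*} [TopologicalSpace X] [LocallyCompactSpace X]
    [FirstCountableTopology X] {K : V3 → ℝ} (hK : Continuous K) {g : X → V3 → ℝ}
    (hg : Continuous (Function.uncurry g)) {x : X → V3} (hx : Continuous x) :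
    Continuous fun p => mollify K (g p) (x p) :=
  continuous_integral_muT (f := fun p y => K (y - x p) * g p y)
    ((hK.comp (continuous_snd.sub (hx.comp continuous_fst))).mul hg)

theorem pd_comp_sub (K : V3 → ℝ) (a : V3) (i : Fin 3) (y : V3) :
    pd (fun y => K (y - a)) i y = pd K i (y - a) := by
  rw [pd, pd, fderiv_comp_sub]

theorem continuous_pd {K : V3 → ℝ} (hK : ContDiff ℝ ∞ K) (i : Fin 3) : Continuous (pd K i) :=
  (hK.continuous_fderiv (by simp)).clm_apply continuous_const

theorem hasFDerivAt_mollify {K g : V3 → ℝ} (hK : ContDiff ℝ ∞ K) (hg : Continuous g) (x : V3) :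
    HasFDerivAt (mollify K g) (∫ y, -(g y • fderiv ℝ K (y - x)) ∂muT) x := by
  have hK' := hK.continuous_fderiv (by simp)
  have hcF : Continuous fun q : V3 × V3 => -(g q.2 • fderiv ℝ K (q.2 - q.1)) := by fun_prop
  obtain ⟨M, hM⟩ := ((isCompact_closedBall x 1).prod
    (isCompact_Icc (a := (0 : V3)) (b := 1))).exists_bound_of_continuousOn hcF.continuousOn
  have hmem : ∀ᵐ y ∂muT, y ∈ Icc (0 : V3) 1 := by
    rw [muT_eq_Icc]
    exact ae_restrict_mem measurableSet_Icc
  refine hasFDerivAt_integral_of_dominated_of_fderiv_le (F := fun x y => K (y - x) * g y)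
    (F' := fun x y => -(g y • fderiv ℝ K (y - x))) (bound := fun _ => M)
    (Metric.closedBall_mem_nhds x one_pos) (Eventually.of_forall fun x => ?_) ?_ ?_ ?_
    (integrable_const M) ?_
  · exact (integrable_muT (by have := hK.continuous; fun_prop)).aestronglyMeasurable
  · exact integrable_muT (by have := hK.continuous; fun_prop)
  · exact (integrable_muT (by fun_prop)).aestronglyMeasurable
  · filter_upwards [hmem] with y hy x' hx'
    exact hM (x', y) ⟨hx', hy⟩
  · refine Eventually.of_forall fun y x' _ => ?_
    have h1 := ((hK.differentiable (by simp)) (y - x')).hasFDerivAt.comp x'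
      ((hasFDerivAt_id x').const_sub y)
    have h2 : HasFDerivAt (fun x => K (y - x) * g y) _ x' := h1.mul_const (g y)
    refine h2.congr_fderiv ?_
    ext
    simp

theorem pd_mollify {K g : V3 → ℝ} (hK : ContDiff ℝ ∞ K) (hg : Continuous g) (i : Fin 3) (x : V3) :
    pd (mollify K g) i x = -mollify (pd K i) g x := by
  have hK' := hK.continuous_fderiv (by simp)
  rw [pd, (hasFDerivAt_mollify hK hg x).fderiv,
    ContinuousLinearMap.integral_apply (integrable_muT (by fun_prop)), mollify, ← integral_neg]
  congr 1 with y
  simp [pd, mul_comm]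

theorem sum_mollify_pd_eq_zero {K : V3 → ℝ} {u : V3 → V3} (hKs : ContDiff ℝ ∞ K) (hK : Per K)
    (hu : Continuous u) (hdiv : ∀ ψ : V3 → ℝ, ContDiff ℝ (⊤ : ℕ∞) ψ → Per ψ →
      (∫ x in cube3, ∑ i, u x i * pd ψ i x) = 0) (x : V3) :
    ∑ i, mollify (pd K i) (fun y => u y i) x = 0 := by
  have h := hdiv (fun y => K (y - x)) (hKs.comp (contDiff_id.sub contDiff_const)) (hK.comp_sub x)
  simp only [pd_comp_sub] at h
  simp only [mollify]
  have hc := continuous_pd hKs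
  rw [← integral_finsetSum _ fun i _ => integrable_muT (by have := hc i; fun_prop)]
  simpa only [mul_comm, muT] using h

namespace IsMollifier

variable {K : V3 → ℝ} {ε C : ℝ}

theorem abs_integral_mul_le (hK : IsMollifier K ε C) {h : V3 → ℝ} {r : ℝ}
    (hb : ∀ z, ‖z‖ ≤ ε → |h z| ≤ r) : |∫ z, K z * h z ∂muQ| ≤ r := by
  have h1 : |∫ z, K z * h z ∂muQ| ≤ ∫ z, K z * r ∂muQ := by
    rw [← Real.norm_eq_abs]
    refine norm_integral_le_of_norm_le
      ((integrable_muQ hK.contDiff.continuous).mul_const r) ?_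
    filter_upwards [ae_restrict_mem (measurableSet_unitBox _)] with z hz
    rw [norm_mul, Real.norm_of_nonneg (hK.nonneg z)]
    by_cases h0 : K z = 0
    · simp [h0]
    · exact mul_le_mul_of_nonneg_left (hb z (hK.norm_le_of_ne_zero z hz h0)) (hK.nonneg z)
  rwa [integral_mul_const, hK.integral_eq_one, one_mul] at h1

theorem abs_integral_pd_mul_le (hK : IsMollifier K ε C) (i : Fin 3) {h : V3 → ℝ} {r : ℝ}
    (hr : 0 ≤ r) (hb : ∀ z, ‖z‖ ≤ ε → |h z| ≤ r) :
    |∫ z, pd K i z * h z ∂muQ| ≤ C / ε * r := by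
  have h1 : |∫ z, pd K i z * h z ∂muQ| ≤ ∫ z, |pd K i z| * r ∂muQ := by
    rw [← Real.norm_eq_abs]
    refine norm_integral_le_of_norm_le
      ((integrable_muQ (continuous_pd hK.contDiff i).abs).mul_const r) ?_
    filter_upwards [ae_restrict_mem (measurableSet_unitBox _)] with z hz
    rw [norm_mul, Real.norm_eq_abs]
    by_cases h0 : pd K i z = 0
    · simp [h0]
    · exact mul_le_mul_of_nonneg_left (hb z (hK.norm_le_of_pd_ne_zero i z hz h0)) (abs_nonneg _)
  rw [integral_mul_const] at h1
  exact h1.trans (mul_le_mul_of_nonneg_right (hK.integral_abs_pd_le i) hr)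

theorem mollify_const (hK : IsMollifier K ε C) (c : ℝ) (x : V3) :
    mollify K (fun _ => c) x = c := by
  rw [mollify_eq hK.per (fun _ _ => rfl), integral_mul_const, hK.integral_eq_one, one_mul]

theorem integral_pd_eq_zero (hK : IsMollifier K ε C) (i : Fin 3) :
    ∫ z, pd K i z ∂muQ = 0 := by
  have h := pd_mollify hK.contDiff (g := fun _ => 1) continuous_const i 0
  rw [mollify_eq (hK.per.pd i) (fun _ _ => rfl),
    show mollify K (fun _ => 1) = fun _ => 1 from funext fun x => hK.mollify_const 1 x] at h
  simpa [pd] using h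

theorem mollify_sub (hK : IsMollifier K ε C) {g : V3 → ℝ} (hg : Continuous g) (hgp : Per g)
    (x : V3) : mollify K g x - g x = ∫ z, K z * (g (x + z) - g x) ∂muQ := by
  have := hK.contDiff.continuous
  simp only [mul_sub]
  rw [integral_sub (integrable_muQ (by fun_prop)) (integrable_muQ (by fun_prop)),
    integral_mul_const, hK.integral_eq_one, one_mul, mollify_eq hK.per hgp]

theorem abs_mollify_sub_le (hK : IsMollifier K ε C) {g : V3 → ℝ} (hg : Continuous g)
    (hgp : Per g) {x : V3} {r : ℝ} (hb : ∀ z, ‖z‖ ≤ ε → |g (x + z) - g x| ≤ r) :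
    |mollify K g x - g x| ≤ r := by
  rw [hK.mollify_sub hg hgp]
  exact hK.abs_integral_mul_le hb

theorem abs_mollify_pd_le (hK : IsMollifier K ε C) (i : Fin 3) {g : V3 → ℝ} (hg : Continuous g)
    (hgp : Per g) {x : V3} {r : ℝ} (hr : 0 ≤ r) (hb : ∀ z, ‖z‖ ≤ ε → |g (x + z) - g x| ≤ r) :
    |mollify (pd K i) g x| ≤ C / ε * r := by
  have hc := continuous_pd hK.contDiff i
  have : mollify (pd K i) g x = ∫ z, pd K i z * (g (x + z) - g x) ∂muQ := by
    simp only [mul_sub]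
    rw [integral_sub (integrable_muQ (by fun_prop)) (integrable_muQ (by fun_prop)),
      integral_mul_const, hK.integral_pd_eq_zero, zero_mul, sub_zero,
      mollify_eq (hK.per.pd i) hgp]
  rw [this]
  exact hK.abs_integral_pd_mul_le i hr hb

theorem abs_commutator_le (hK : IsMollifier K ε C) {u θ : V3 → ℝ} (hu : Continuous u)
    (hup : Per u) (hθ : Continuous θ) (hθp : Per θ) {x : V3} {a b : ℝ} (ha : 0 ≤ a)
    (hua : ∀ z, ‖z‖ ≤ ε → |u (x + z) - u x| ≤ a) (hθb : ∀ z, ‖z‖ ≤ ε → |θ (x + z) - θ x| ≤ b) :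
    |mollify K (fun y => u y * θ y) x - mollify K u x * mollify K θ x| ≤ 2 * (a * b) := by
  have hc := hK.contDiff.continuous
  have key : mollify K (fun y => u y * θ y) x - mollify K u x * mollify K θ x =
      ∫ z, K z * ((u (x + z) - u x) * (θ (x + z) - θ x)) ∂muQ -
        (mollify K u x - u x) * (mollify K θ x - θ x) := by
    have h1 : ∀ z, K z * ((u (x + z) - u x) * (θ (x + z) - θ x)) =
        K z * (u (x + z) * θ (x + z)) - u x * (K z * (θ (x + z) - θ x)) -
          θ x * (K z * (u (x + z) - u x)) - u x * θ x * K z := fun z => by ring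
    simp only [h1]
    rw [integral_sub (integrable_muQ (by fun_prop)) (integrable_muQ (by fun_prop)),
      integral_sub (integrable_muQ (by fun_prop)) (integrable_muQ (by fun_prop)),
      integral_sub (integrable_muQ (by fun_prop)) (integrable_muQ (by fun_prop)),
      integral_const_mul, integral_const_mul, integral_const_mul, hK.integral_eq_one,
      ← hK.mollify_sub hu hup, ← hK.mollify_sub hθ hθp, mollify_eq hK.per (hup.mul hθp)]
    ring
  rw [key]
  refine (abs_sub _ _).trans ?_
  rw [two_mul]
  refine add_le_add (hK.abs_integral_mul_le fun z hz => ?_)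
    ((abs_mul _ _).trans_le (mul_le_mul (hK.abs_mollify_sub_le hu hup hua)
      (hK.abs_mollify_sub_le hθ hθp hθb) (abs_nonneg _) ha))
  rw [abs_mul]
  exact mul_le_mul (hua z hz) (hθb z hz) (abs_nonneg _) ha

theorem integral_flux_eq (hK : IsMollifier K ε C) {u : V3 → V3} {θ : V3 → ℝ} (hu : Continuous u)
    (hθ : Continuous θ)
    (hdiv : ∀ ψ : V3 → ℝ, ContDiff ℝ (⊤ : ℕ∞) ψ → Per ψ →
      (∫ x in cube3, ∑ i, u x i * pd ψ i x) = 0)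
    {f f₁ f₂ : ℝ → ℝ} (hf : ∀ s, HasDerivAt f (f₁ s) s) (hf₁ : ∀ s, HasDerivAt f₁ (f₂ s) s)
    (hf₂ : Continuous f₂) :
    ∫ x, f₁ (mollify K θ x) * ∑ i, mollify (pd K i) (fun y => u y i * θ y) x ∂muT =
      -∫ x, f₂ (mollify K θ x) * ∑ i, mollify (pd K i) θ x *
        (mollify K (fun y => u y i * θ y) x - mollify K (fun y => u y i) x * mollify K θ x)
          ∂muT := by
  have hcf : Continuous f := continuous_iff_continuousAt.2 fun s => (hf s).continuousAt
  have hcf₁ : Continuous f₁ := continuous_iff_continuousAt.2 fun s => (hf₁ s).continuousAt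
  have hcK := hK.contDiff.continuous
  have hcK' := continuous_pd hK.contDiff
  have hm : ∀ {L g : V3 → ℝ}, Continuous L → Continuous g → Continuous (mollify L g) :=
    fun {L g} hL hg => continuous_mollify (X := V3) (g := fun _ => g) hL
      (hg.comp continuous_snd) continuous_id
  have hui : ∀ i, Continuous fun y => u y i := fun i => by fun_prop
  have huθ : ∀ i, Continuous fun y => u y i * θ y := fun i => by fun_prop
  have h1 := hm hcK hθ
  have h2 := fun i => hm hcK (hui i)
  have h3 := fun i => hm hcK (huθ i)
  have h4 := fun i => hm (hcK' i) hθ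
  have h5 := fun i => hm (hcK' i) (huθ i)
  have hD : ∀ {g : V3 → ℝ} (x : V3), Continuous g →
      HasFDerivAt (mollify K g) (fderiv ℝ (mollify K g) x) x := fun x hg =>
    (hasFDerivAt_mollify hK.contDiff hg x).differentiableAt.hasFDerivAt
  let F : Fin 3 → V3 → ℝ := fun i x =>
    f₁ (mollify K θ x) * mollify K (fun y => u y i * θ y) x -
      (mollify K θ x * f₁ (mollify K θ x) - f (mollify K θ x)) * mollify K (fun y => u y i) x
  have hF : ∀ i, Per (F i) := fun i x k => by
    simp only [F, per_mollify hK.per _ x k]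
  have hpd : ∀ {g : V3 → ℝ} (i x), Continuous g → fderiv ℝ (mollify K g) x (Pi.single i 1) =
      -mollify (pd K i) g x := fun i x hg => pd_mollify hK.contDiff hg i x
  have hd : ∀ i x, ∃ L : V3 →L[ℝ] ℝ, HasFDerivAt (F i) L x ∧ L (Pi.single i 1) =
      -(f₁ (mollify K θ x) * mollify (pd K i) (fun y => u y i * θ y) x +
        f₂ (mollify K θ x) * (mollify (pd K i) θ x *
          (mollify K (fun y => u y i * θ y) x - mollify K (fun y => u y i) x * mollify K θ x)) -
        (mollify K θ x * f₁ (mollify K θ x) - f (mollify K θ x)) *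
          mollify (pd K i) (fun y => u y i) x) := fun i x => by
    refine ⟨_, ((((hf₁ _).comp_hasFDerivAt x (hD x hθ)).mul (hD x (huθ i))).sub
      ((((hD x hθ).mul ((hf₁ _).comp_hasFDerivAt x (hD x hθ))).sub
        ((hf _).comp_hasFDerivAt x (hD x hθ))).mul (hD x (hui i)))), ?_⟩
    simp only [sub_apply, add_apply, smul_apply, smul_eq_mul, Function.comp_apply, Pi.sub_apply,
      Pi.mul_apply, hpd i x hθ, hpd i x (hui i), hpd i x (huθ i)]
    ring
  choose F' hF' hF'e using hd
  have hdiv' := sum_mollify_pd_eq_zero hK.contDiff hK.per hu hdiv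
  have key := Per.integral_pd_eq_zero hF hF'
  simp only [hF'e, Finset.sum_neg_distrib, Finset.sum_sub_distrib, Finset.sum_add_distrib,
    ← Finset.mul_sum, hdiv', mul_zero, sub_zero] at key
  have key' := key (by fun_prop)
  rw [integral_neg, integral_add (integrable_muT (by fun_prop)) (integrable_muT (by fun_prop))]
    at key'
  linarith

theorem abs_integral_flux_le (hK : IsMollifier K ε C) {u : V3 → V3} {θ : V3 → ℝ}
    (hu : Continuous u) (hup : Per u) (hθ : Continuous θ) (hθp : Per θ)
    (hdiv : ∀ ψ : V3 → ℝ, ContDiff ℝ (⊤ : ℕ∞) ψ → Per ψ →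
      (∫ x in cube3, ∑ i, u x i * pd ψ i x) = 0)
    {f f₁ f₂ : ℝ → ℝ} (hf : ∀ s, HasDerivAt f (f₁ s) s) (hf₁ : ∀ s, HasDerivAt f₁ (f₂ s) s)
    (hf₂ : Continuous f₂) {M a b : ℝ} (hM : ∀ s, |f₂ s| ≤ M) (ha : 0 ≤ a) (hb : 0 ≤ b)
    (hua : ∀ x z, ‖z‖ ≤ ε → ‖u (x + z) - u x‖ ≤ a)
    (hθb : ∀ x z, ‖z‖ ≤ ε → |θ (x + z) - θ x| ≤ b) :
    |∫ x, f₁ (mollify K θ x) * ∑ i, mollify (pd K i) (fun y => u y i * θ y) x ∂muT| ≤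
      M * (3 * (C / ε * b * (2 * (a * b)))) := by
  rw [hK.integral_flux_eq hu hθ hdiv hf hf₁ hf₂, abs_neg, ← Real.norm_eq_abs]
  have hM0 : 0 ≤ M := (abs_nonneg _).trans (hM 0)
  refine (norm_integral_le_of_norm_le_const (Eventually.of_forall fun x => ?_)).trans
    (by rw [probReal_univ, mul_one])
  rw [norm_mul]
  refine mul_le_mul (hM _) ((Finset.abs_sum_le_sum_abs _ _).trans ?_) (norm_nonneg _) hM0
  refine (Finset.sum_le_card_nsmul _ _ (C / ε * b * (2 * (a * b))) fun i _ => ?_).trans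
    (by simp)
  rw [abs_mul]
  have h1 := hK.abs_mollify_pd_le i hθ hθp hb (hθb x)
  refine mul_le_mul h1 (hK.abs_commutator_le (by fun_prop) (hup.comp fun w => w i) hθ hθp ha
    (fun z hz => ?_) (hθb x)) (abs_nonneg _) ((abs_nonneg _).trans h1)
  exact (norm_le_pi_norm (u (x + z) - u x) i).trans (hua x z hz)

end IsMollifier

theorem eq_add_integral_of_weak {T a : ℝ} (hT : 0 < T) {g G : ℝ → ℝ} (hg : Continuous g)
    (hG : Continuous G)
    (h : ∀ η : ℝ → ℝ, ContDiff ℝ ∞ η → (∃ T' < T, ∀ t, T' ≤ t → η t = 0) →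
      -(a * η 0) - ∫ s in Icc 0 T, deriv η s * g s = ∫ s in Icc 0 T, η s * G s)
    {t : ℝ} (ht : t ∈ Icc 0 T) : g t = a + ∫ s in 0..t, G s := by
  set w : ℝ → ℝ := fun t => a + ∫ s in 0..t, G s with hw
  have hwd : ∀ t, HasDerivAt w (G t) t := fun t =>
    (hG.integral_hasStrictDerivAt 0 t).hasDerivAt.const_add a
  have hwc : Continuous w := continuous_iff_continuousAt.2 fun t => (hwd t).continuousAt
  have hgw : Continuous fun t => g t - w t := hg.sub hwc
  have hae : ∀ᵐ t, t ∈ Ioo 0 T → g t - w t = 0 := by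
    refine isOpen_Ioo.ae_eq_zero_of_integral_contDiff_smul_eq_zero
      (hgw.locallyIntegrable.locallyIntegrableOn _) fun ζ hζ hζc hζs => ?_
    obtain ⟨T', hT', hζT⟩ : ∃ T' < T, ∀ t, T' < t → ζ t = 0 := by
      rcases (tsupport ζ).eq_empty_or_nonempty with h0 | h0
      · exact ⟨0, hT, fun t _ => image_eq_zero_of_notMem_tsupport (by simp [h0])⟩
      · obtain ⟨m, hm, hm'⟩ := hζc.isCompact.exists_isGreatest h0
        exact ⟨m, (hζs hm).2, fun t htm => image_eq_zero_of_notMem_tsupport fun h' =>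
          (hm' h').not_gt htm⟩
    set η : ℝ → ℝ := fun t => ∫ s in T..t, ζ s with hη
    have hηd : ∀ t, HasDerivAt η (ζ t) t := fun t =>
      (hζ.continuous.integral_hasStrictDerivAt T t).hasDerivAt
    have hηs : ContDiff ℝ ∞ η := by
      rw [contDiff_infty_iff_deriv, show deriv η = ζ from funext fun t => (hηd t).deriv]
      exact ⟨fun t => (hηd t).differentiableAt, hζ⟩
    have hη0 : ∀ t, (T' + T) / 2 ≤ t → η t = 0 := by
      intro t ht
      refine intervalIntegral.integral_zero_ae (Eventually.of_forall fun s hs => hζT s ?_)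
      have : min T t < s := hs.1
      rcases min_lt_iff.1 this with h | h <;> linarith
    have key := h η hηs ⟨(T' + T) / 2, by linarith, hη0⟩
    have hηT : η T = 0 := hη0 T (by linarith)
    simp only [fun s => (hηd s).deriv, integral_Icc_eq_integral_Ioc,
      ← intervalIntegral.integral_of_le hT.le] at key
    rw [intervalIntegral.integral_mul_deriv_eq_deriv_mul (fun s _ => hηd s) (fun s _ => hwd s)
      (hζ.continuous.intervalIntegrable _ _) (hG.intervalIntegrable _ _), hηT] at key
    have hζc := hζ.continuous
    rw [← setIntegral_eq_integral_of_forall_compl_eq_zero (s := Ioc 0 T) fun s hs => ?_,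
      ← intervalIntegral.integral_of_le hT.le]
    · simp only [smul_eq_mul, mul_sub]
      rw [intervalIntegral.integral_sub (f := fun x => ζ x * g x) (g := fun x => ζ x * w x)
        ((hζc.mul hg).intervalIntegrable _ _) ((hζc.mul hwc).intervalIntegrable _ _)]
      have : w 0 = a := by simp [hw]
      rw [this] at key
      linarith
    · rw [image_eq_zero_of_notMem_tsupport fun h' => hs (Ioo_subset_Ioc_self (hζs h')), zero_smul]
  have hEq : EqOn (fun t => g t - w t) (fun _ => 0) (Ioo 0 T) :=
    Measure.eqOn_open_of_ae_eq ((ae_restrict_iff' measurableSet_Ioo).2 hae) isOpen_Ioo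
      hgw.continuousOn continuousOn_const
  have hcl := hEq.closure hgw continuous_const
  rw [closure_Ioo hT.ne] at hcl
  exact sub_eq_zero.1 (hcl ht)

theorem comp_sub_eq_integral {T a : ℝ} {g G : ℝ → ℝ} (hG : Continuous G)
    (h : ∀ t ∈ Icc 0 T, g t = a + ∫ s in 0..t, G s) {f f₁ : ℝ → ℝ}
    (hf : ∀ s, HasDerivAt f (f₁ s) s) (hf₁ : Continuous f₁) {t : ℝ} (ht : t ∈ Icc 0 T) :
    f (g t) - f a = ∫ s in 0..t, f₁ (g s) * G s := by
  have hwd : ∀ t, HasDerivAt (fun t => a + ∫ s in 0..t, G s) (G t) t := fun t =>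
    (hG.integral_hasStrictDerivAt 0 t).hasDerivAt.const_add a
  have hwc : Continuous fun t => a + ∫ s in 0..t, G s :=
    continuous_iff_continuousAt.2 fun t => (hwd t).continuousAt
  have hint := intervalIntegral.integral_eq_sub_of_hasDerivAt (a := 0) (b := t)
    (fun s _ => (hf _).comp s (hwd s)) (((hf₁.comp hwc).mul hG).intervalIntegrable _ _)
  rw [intervalIntegral.integral_congr (g := fun s => f₁ (a + ∫ s in 0..s, G s) * G s)
    fun s hs => ?_, h t ht]
  · simpa using hint.symm
  · rw [uIcc_of_le ht.1] at hs
    simp only [h s ⟨hs.1, hs.2.trans ht.2⟩]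

theorem tendsto_integral_comp_mollify {K : ℕ → V3 → ℝ} {ε : ℕ → ℝ} {C : ℝ}
    (hK : ∀ n, IsMollifier (K n) (ε n) C) (hε : Tendsto ε atTop (𝓝 0)) {g : V3 → ℝ}
    (hg : Continuous g) (hgp : Per g) {f : ℝ → ℝ} (hf : Continuous f) {M : ℝ}
    (hM : ∀ s, |f s| ≤ M) :
    Tendsto (fun n => ∫ x, f (mollify (K n) g x) ∂muT) atTop (𝓝 (∫ x, f (g x) ∂muT)) := by
  have hc : ∀ n, Continuous (mollify (K n) g) := fun n =>
    continuous_mollify (X := V3) (g := fun _ => g) (hK n).contDiff.continuous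
      (hg.comp continuous_snd) continuous_id
  refine tendsto_integral_of_dominated_convergence (fun _ => M)
    (fun n => (integrable_muT (hf.comp (hc n))).aestronglyMeasurable) (integrable_const M)
    (fun n => Eventually.of_forall fun x => hM _) (Eventually.of_forall fun x => ?_)
  refine (hf.tendsto _).comp (Metric.tendsto_nhds.2 fun δ hδ => ?_)
  obtain ⟨r, hr, hgr⟩ := Metric.continuous_iff.1 hg x (δ / 2) (half_pos hδ)
  filter_upwards [hε.eventually_lt_const hr] with n hn
  refine lt_of_le_of_lt ((hK n).abs_mollify_sub_le hg hgp fun z hz => ?_) (half_lt_self hδ)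
  exact (hgr (x + z) (by simpa [dist_eq_norm] using hz.trans_lt hn)).le

theorem map_eq_of_integral_comp_eq {θ₁ θ₂ : V3 → ℝ} (h₁ : Continuous θ₁) (h₂ : Continuous θ₂)
    (hcos : ∀ ξ : ℝ, ∫ x, cos (ξ * θ₁ x) ∂muT = ∫ x, cos (ξ * θ₂ x) ∂muT)
    (hsin : ∀ ξ : ℝ, ∫ x, sin (ξ * θ₁ x) ∂muT = ∫ x, sin (ξ * θ₂ x) ∂muT) :
    muT.map θ₁ = muT.map θ₂ := by
  refine Measure.ext_of_charFun (funext fun ξ => ?_)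
  have key : ∀ {θ : V3 → ℝ}, Continuous θ → charFun (muT.map θ) ξ =
      ((∫ x, cos (ξ * θ x) ∂muT : ℝ) : ℂ) + ((∫ x, sin (ξ * θ x) ∂muT : ℝ) : ℂ) * Complex.I := by
    intro θ hθ
    have hc : ((∫ x, cos (ξ * θ x) ∂muT : ℝ) : ℂ) = ∫ x, ((cos (ξ * θ x) : ℝ) : ℂ) ∂muT :=
      integral_ofReal.symm
    have hs : ((∫ x, sin (ξ * θ x) ∂muT : ℝ) : ℂ) = ∫ x, ((sin (ξ * θ x) : ℝ) : ℂ) ∂muT :=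
      integral_ofReal.symm
    rw [charFun_apply_real, integral_map hθ.aemeasurable (by fun_prop), hc, hs,
      ← integral_mul_const, ← integral_add]
    · congr 1 with x
      rw [← Complex.ofReal_mul, Complex.exp_mul_I, Complex.ofReal_cos, Complex.ofReal_sin]
    · exact integrable_muT (by fun_prop)
    · exact integrable_muT (by fun_prop)
  rw [key h₁, key h₂, hcos, hsin]

namespace IsWeakBoussinesq

variable {T : ℝ} {vin : V3 → V3} {θin : V3 → ℝ} {v : ℝ → V3 → V3} {θ : ℝ → V3 → ℝ}
  {V : ℝ → V3 → V3} {Θ : ℝ → V3 → ℝ} {K : V3 → ℝ}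

theorem mollify_eq_add_integral (hw : IsWeakBoussinesq T vin θin v θ) (hT : 0 < T)
    (hV : Continuous (Function.uncurry V)) (hΘ : Continuous (Function.uncurry Θ))
    (hVv : ∀ t ∈ Icc 0 T, V t = v t) (hΘθ : ∀ t ∈ Icc 0 T, Θ t = θ t)
    (hK : ContDiff ℝ ∞ K) (hKp : Per K) (x : V3) {t : ℝ} (ht : t ∈ Icc 0 T) :
    mollify K (Θ t) x = mollify K θin x +
      ∫ s in 0..t, ∑ i, mollify (pd K i) (fun y => V s y i * Θ s y) x := by
  have hpd := continuous_pd hK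
  have hVΘ : ∀ i, Continuous (Function.uncurry fun s y => V s y i * Θ s y) := fun i =>
    ((continuous_apply i).comp hV).mul hΘ
  refine eq_add_integral_of_weak (g := fun t => mollify K (Θ t) x) hT
    (continuous_mollify hK.continuous hΘ continuous_const)
    (continuous_finsetSum _ fun i _ => continuous_mollify (hpd i) (hVΘ i) continuous_const)
    (fun η hη hηT => ?_) ht
  obtain ⟨T', hT', hη0⟩ := hηT
  have key := hw.transport (fun s y => η s * K (y - x))
    ⟨by fun_prop, fun s z k => by simp only [hKp.comp_sub x z k], T', hT', fun s y hs => by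
      simp only [hη0 s hs, zero_mul]⟩
  have hL : ∀ s y, deriv (fun r => η r * K (y - x)) s = deriv η s * K (y - x) := fun s y =>
    deriv_mul_const (hη.differentiable (by simp) s) _
  have hR : ∀ s i y, pd (fun y => η s * K (y - x)) i y = η s * pd K i (y - x) := by
    intro s i y
    have hd : DifferentiableAt ℝ (fun y => K (y - x)) y :=
      (hK.differentiable (by simp)).comp (differentiable_id.sub_const x) y
    rw [← pd_comp_sub, pd, fderiv_const_mul hd]
    rfl
  have h1 : ∫ y in cube3, θin y * (η 0 * K (y - x)) = mollify K θin x * η 0 := by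
    rw [mollify, ← integral_mul_const]
    exact integral_congr_ae (Eventually.of_forall fun y => by simp only; ring)
  have h2 : ∀ s ∈ Icc 0 T, ∫ y in cube3, deriv η s * K (y - x) * θ s y =
      deriv η s * mollify K (Θ s) x := by
    intro s hs
    rw [mollify, ← integral_const_mul, hΘθ s hs]
    exact integral_congr_ae (Eventually.of_forall fun y => by simp only; ring)
  have h3 : ∀ s ∈ Icc 0 T, ∫ y in cube3, (∑ i, v s y i * (η s * pd K i (y - x))) * θ s y =
      η s * ∑ i, mollify (pd K i) (fun y => V s y i * Θ s y) x := by
    intro s hs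
    simp only [mollify]
    rw [← integral_finsetSum _ fun i _ => integrable_muT ?_, ← integral_const_mul,
      ← hVv s hs, ← hΘθ s hs]
    · refine integral_congr_ae (Eventually.of_forall fun y => ?_)
      simp only [Finset.sum_mul, Finset.mul_sum]
      exact Finset.sum_congr rfl fun i _ => by ring
    · have := hpd i
      have := (hVΘ i).comp (Continuous.prodMk_right s)
      simp only [Function.comp_def, Function.uncurry_apply_pair] at this
      fun_prop
  simp only [hL, hR] at key
  rw [h1, setIntegral_congr_fun measurableSet_Icc h2, setIntegral_congr_fun measurableSet_Icc h3]
    at key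
  exact key

theorem abs_integral_comp_mollify_sub_le (hw : IsWeakBoussinesq T vin θin v θ) (hT : 0 < T)
    (hθin : Continuous θin)
    (hV : Continuous (Function.uncurry V)) (hΘ : Continuous (Function.uncurry Θ))
    (hVv : ∀ t ∈ Icc 0 T, V t = v t) (hΘθ : ∀ t ∈ Icc 0 T, Θ t = θ t)
    {ε C : ℝ} (hK : IsMollifier K ε C)
    {f f₁ f₂ : ℝ → ℝ} (hf : ∀ s, HasDerivAt f (f₁ s) s) (hf₁ : ∀ s, HasDerivAt f₁ (f₂ s) s)
    (hf₂ : Continuous f₂) {M a b : ℝ} (hM : ∀ s, |f₂ s| ≤ M) (ha : 0 ≤ a) (hb : 0 ≤ b)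
    (hua : ∀ t ∈ Icc 0 T, ∀ x z, ‖z‖ ≤ ε → ‖v t (x + z) - v t x‖ ≤ a)
    (hθb : ∀ t ∈ Icc 0 T, ∀ x z, ‖z‖ ≤ ε → |θ t (x + z) - θ t x| ≤ b) {t : ℝ}
    (ht : t ∈ Icc 0 T) :
    |∫ x, f (mollify K (θ t) x) ∂muT - ∫ x, f (mollify K θin x) ∂muT| ≤
      M * (3 * (C / ε * b * (2 * (a * b)))) * t := by
  have hfc : Continuous f := continuous_iff_continuousAt.2 fun s => (hf s).continuousAt
  have hf₁c : Continuous f₁ := continuous_iff_continuousAt.2 fun s => (hf₁ s).continuousAt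
  have hKc := hK.contDiff.continuous
  have hpd := continuous_pd hK.contDiff
  have hslice : ∀ s, Continuous (Θ s) := fun s => hΘ.comp (Continuous.prodMk_right s)
  have hVΘ : ∀ i, Continuous (Function.uncurry fun s y => V s y i * Θ s y) := fun i =>
    ((continuous_apply i).comp hV).mul hΘ
  have hG : Continuous fun q : ℝ × V3 =>
      ∑ i, mollify (pd K i) (fun y => V q.1 y i * Θ q.1 y) q.2 :=
    continuous_finsetSum _ fun i _ => continuous_mollify (X := ℝ × V3)
      (g := fun q y => V q.1 y i * Θ q.1 y) (hpd i)
      ((hVΘ i).comp ((continuous_fst.comp continuous_fst).prodMk continuous_snd)) continuous_snd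
  have hg : Continuous fun q : ℝ × V3 => mollify K (Θ q.1) q.2 :=
    continuous_mollify (X := ℝ × V3) (g := fun q => Θ q.1) hKc
      (hΘ.comp ((continuous_fst.comp continuous_fst).prodMk continuous_snd)) continuous_snd
  have hF : Continuous fun q : ℝ × V3 => f₁ (mollify K (Θ q.1) q.2) *
      ∑ i, mollify (pd K i) (fun y => V q.1 y i * Θ q.1 y) q.2 := (hf₁c.comp hg).mul hG
  have hθm : Continuous (mollify K θin) :=
    continuous_mollify (X := V3) (g := fun _ => θin) hKc (hθin.comp continuous_snd) continuous_id
  have hgt : Continuous (mollify K (Θ t)) := hg.comp (Continuous.prodMk_right t)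
  have hpt : ∀ x, f (mollify K (Θ t) x) - f (mollify K θin x) =
      ∫ s in Ioc 0 t, f₁ (mollify K (Θ s) x) *
        ∑ i, mollify (pd K i) (fun y => V s y i * Θ s y) x := fun x => by
    rw [← intervalIntegral.integral_of_le ht.1]
    exact comp_sub_eq_integral (g := fun s => mollify K (Θ s) x)
      (hG.comp (Continuous.prodMk_left x))
      (fun s hs => hw.mollify_eq_add_integral hT hV hΘ hVv hΘθ hK.contDiff hK.per x hs) hf hf₁c ht
  have hint : Integrable (fun q : V3 × ℝ => f₁ (mollify K (Θ q.2) q.1) *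
      ∑ i, mollify (pd K i) (fun y => V q.2 y i * Θ q.2 y) q.1)
      (muT.prod (volume.restrict (Ioc 0 t))) := by
    rw [muT_eq_Icc, Measure.prod_restrict]
    exact ((hF.comp continuous_swap).continuousOn.integrableOn_compact
      (isCompact_Icc.prod isCompact_Icc)).mono_set (prod_mono_right Ioc_subset_Icc_self)
  rw [← hΘθ t ht, ← integral_sub (f := fun x => f (mollify K (Θ t) x))
    (g := fun x => f (mollify K θin x)) (integrable_muT (hfc.comp hgt))
    (integrable_muT (hfc.comp hθm))]
  simp only [hpt]
  rw [integral_integral_swap hint, ← Real.norm_eq_abs]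
  refine (norm_setIntegral_le_of_norm_le_const_ae' (by simp) ?_).trans_eq
    (by rw [Real.volume_real_Ioc_of_le ht.1, sub_zero])
  have hdiv := (ae_restrict_iff' measurableSet_Icc).1 hw.divfree
  filter_upwards [hdiv] with s hs hst
  have hsT : s ∈ Icc 0 T := ⟨hst.1.le, hst.2.trans ht.2⟩
  have hVs : Continuous (V s) := hV.comp (Continuous.prodMk_right s)
  rw [Real.norm_eq_abs]
  refine hK.abs_integral_flux_le hVs (hVv s hsT ▸ hw.perv s) (hslice s) (hΘθ s hsT ▸ hw.perθ s)
    (hVv s hsT ▸ hs hsT) hf hf₁ hf₂ hM ha hb ?_ ?_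
  · rw [hVv s hsT]
    exact hua s hsT
  · rw [hΘθ s hsT]
    exact hθb s hsT

theorem integral_comp_eq (hw : IsWeakBoussinesq T vin θin v θ) (hT : 0 < T)
    (hθin : Continuous θin) (hθp : Per θin) {β Cv Cθ : ℝ} (hβ : 1 / 3 < β)
    (hv : ∀ t ∈ Icc 0 T, ∀ x y : V3, ‖v t x - v t y‖ ≤ Cv * ‖x - y‖ ^ β)
    (hθ : ∀ t ∈ Icc 0 T, ∀ x y : V3, |θ t x - θ t y| ≤ Cθ * ‖x - y‖ ^ β)
    {f f₁ f₂ : ℝ → ℝ} (hf : ∀ s, HasDerivAt f (f₁ s) s) (hf₁ : ∀ s, HasDerivAt f₁ (f₂ s) s)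
    (hf₂ : Continuous f₂) {M : ℝ} (hM₀ : ∀ s, |f s| ≤ M) (hM : ∀ s, |f₂ s| ≤ M) {t : ℝ}
    (ht : t ∈ Icc 0 T) :
    ∫ x, f (θ t x) ∂muT = ∫ x, f (θin x) ∂muT := by
  have hfc : Continuous f := continuous_iff_continuousAt.2 fun s => (hf s).continuousAt
  have hproj : Continuous fun q : ℝ × V3 => ((projIcc 0 T hT.le q.1 : ℝ), q.2) :=
    (continuous_subtype_val.comp (continuous_projIcc.comp continuous_fst)).prodMk continuous_snd
  have hmem : ∀ q : ℝ × V3, ((projIcc 0 T hT.le q.1 : ℝ), q.2) ∈ Icc 0 T ×ˢ (univ : Set V3) :=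
    fun q => ⟨(projIcc 0 T hT.le q.1).2, mem_univ _⟩
  have hV : Continuous (Function.uncurry fun s => v (projIcc 0 T hT.le s)) :=
    hw.contv.comp_continuous hproj hmem
  have hΘ : Continuous (Function.uncurry fun s => θ (projIcc 0 T hT.le s)) :=
    hw.contθ.comp_continuous hproj hmem
  have hVv : ∀ s ∈ Icc 0 T, v (projIcc 0 T hT.le s) = v s := fun s hs => by
    rw [projIcc_of_mem hT.le hs]
  have hΘθ : ∀ s ∈ Icc 0 T, θ (projIcc 0 T hT.le s) = θ s := fun s hs => by
    rw [projIcc_of_mem hT.le hs]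
  have hθt : Continuous (θ t) := hΘθ t ht ▸ hΘ.comp (Continuous.prodMk_right t)
  obtain ⟨C, hC⟩ := exists_isMollifier
  have hε : ∀ n : ℕ, (0 : ℝ) < 1 / ((n : ℝ) + 2) := fun n => by positivity
  have hε' : ∀ n : ℕ, 1 / ((n : ℝ) + 2) ≤ 1 / 2 := fun n =>
    one_div_le_one_div_of_le two_pos (by linarith [n.cast_nonneg (α := ℝ)])
  choose K hK using fun n : ℕ => hC _ (hε n) (hε' n)
  have hlim : Tendsto (fun n : ℕ => 1 / ((n : ℝ) + 2)) atTop (𝓝 0) :=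
    tendsto_const_nhds.div_atTop (tendsto_natCast_atTop_atTop.atTop_add tendsto_const_nhds)
  have holder : ∀ {c r z ε : ℝ}, r ≤ c * z ^ β → 0 ≤ z → z ≤ ε → r ≤ |c| * ε ^ β :=
    fun h hz hzε => h.trans (mul_le_mul (le_abs_self _)
      (rpow_le_rpow hz hzε (by linarith)) (rpow_nonneg hz _) (abs_nonneg _))
  have hbound : ∀ n : ℕ,
      |∫ x, f (mollify (K n) (θ t) x) ∂muT - ∫ x, f (mollify (K n) θin x) ∂muT| ≤
        M * 6 * C * |Cv| * |Cθ| ^ 2 * t * (1 / ((n : ℝ) + 2)) ^ (3 * β - 1) := by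
    intro n
    refine (hw.abs_integral_comp_mollify_sub_le hT hθin hV hΘ hVv hΘθ (hK n) hf hf₁ hf₂ hM
      (a := |Cv| * (1 / ((n : ℝ) + 2)) ^ β) (b := |Cθ| * (1 / ((n : ℝ) + 2)) ^ β)
      (by positivity) (by positivity)
      (fun s hs x z hz => holder (hv s hs _ _) (norm_nonneg _) (by simpa using hz))
      (fun s hs x z hz => holder (hθ s hs _ _) (norm_nonneg _) (by simpa using hz)) ht).trans_eq ?_
    have h3 : (1 / ((n : ℝ) + 2)) ^ (3 * β - 1) =
        ((1 / ((n : ℝ) + 2)) ^ β) ^ 3 / (1 / ((n : ℝ) + 2)) := by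
      rw [rpow_sub (hε n), rpow_one, mul_comm, rpow_mul (hε n).le]
      norm_cast
    rw [h3]
    ring
  have hzero : Tendsto (fun n : ℕ => M * 6 * C * |Cv| * |Cθ| ^ 2 * t *
      (1 / ((n : ℝ) + 2)) ^ (3 * β - 1)) atTop (𝓝 0) := by
    have := (hlim.rpow_const (p := 3 * β - 1) (Or.inr (by linarith))).const_mul
      (M * 6 * C * |Cv| * |Cθ| ^ 2 * t)
    rwa [zero_rpow (by linarith), mul_zero] at this
  have h0 := squeeze_zero_norm (f := fun n => ∫ x, f (mollify (K n) (θ t) x) ∂muT -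
    ∫ x, f (mollify (K n) θin x) ∂muT) hbound hzero
  have h1 := (tendsto_integral_comp_mollify hK hlim hθt (hw.perθ t) hfc hM₀).sub
    (tendsto_integral_comp_mollify hK hlim hθin hθp hfc hM₀)
  exact sub_eq_zero.1 (tendsto_nhds_unique h1 h0)

theorem map_eq (hw : IsWeakBoussinesq T vin θin v θ) (hT : 0 < T)
    (hθin : Continuous θin) (hθp : Per θin) {β Cv Cθ : ℝ} (hβ : 1 / 3 < β)
    (hv : ∀ t ∈ Icc 0 T, ∀ x y : V3, ‖v t x - v t y‖ ≤ Cv * ‖x - y‖ ^ β)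
    (hθ : ∀ t ∈ Icc 0 T, ∀ x y : V3, |θ t x - θ t y| ≤ Cθ * ‖x - y‖ ^ β)
    {t : ℝ} (ht : t ∈ Icc 0 T) (hθt : Continuous (θ t)) : muT.map (θ t) = muT.map θin := by
  have hcos : ∀ ξ s : ℝ, HasDerivAt (fun s => cos (ξ * s)) (-ξ * sin (ξ * s)) s := fun ξ s => by
    simpa [mul_comm] using ((hasDerivAt_id s).const_mul ξ).cos
  have hsin : ∀ ξ s : ℝ, HasDerivAt (fun s => sin (ξ * s)) (ξ * cos (ξ * s)) s := fun ξ s => by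
    simpa [mul_comm] using ((hasDerivAt_id s).const_mul ξ).sin
  have hle : ∀ ξ r : ℝ, |r| ≤ 1 → |ξ * (ξ * r)| ≤ 1 + ξ ^ 2 := fun ξ r hr => by
    rw [← mul_assoc, abs_mul, abs_mul_self]
    nlinarith [mul_self_nonneg ξ]
  have hle' : ∀ ξ r : ℝ, |r| ≤ 1 → |r| ≤ 1 + ξ ^ 2 := fun ξ r hr => by nlinarith [sq_nonneg ξ]
  refine map_eq_of_integral_comp_eq hθt hθin (fun ξ => ?_) fun ξ => ?_
  · refine hw.integral_comp_eq hT hθin hθp hβ hv hθ (hcos ξ)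
      (fun s => (hsin ξ s).const_mul (-ξ)) (by fun_prop) (fun s => hle' ξ _ (abs_cos_le_one _))
      (fun s => ?_) ht
    rw [neg_mul, abs_neg]
    exact hle ξ _ (abs_cos_le_one _)
  · refine hw.integral_comp_eq hT hθin hθp hβ hv hθ (hsin ξ)
      (fun s => (hcos ξ s).const_mul ξ) (by fun_prop) (fun s => hle' ξ _ (abs_sin_le_one _))
      (fun s => ?_) ht
    rw [neg_mul, mul_neg, abs_neg]
    exact hle ξ _ (abs_sin_le_one _)

end IsWeakBoussinesq

end Conservation

/-- for `β > 1/3` and `1 ≤ p ≤ ∞`, every weak solution of the inviscid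
Boussinesq system of class `C_t C^β_x` conserves the `L^p` norm of the temperature. -/
theorem stmt1 (T β : ℝ) (hT : 0 < T) (hβ : 1/3 < β) (p : ℝ≥0∞) (hp : 1 ≤ p)
    (vin : V3 → V3) (θin : V3 → ℝ) (hdata : SmoothData vin θin)
    (v : ℝ → V3 → V3) (θ : ℝ → V3 → ℝ)
    (hw : IsWeakBoussinesq T vin θin v θ)
    (hv : ∃ C : ℝ, ∀ t ∈ Icc (0:ℝ) T, ∀ x y : V3, ‖v t x - v t y‖ ≤ C * ‖x - y‖ ^ β)
    (hθ : ∃ C : ℝ, ∀ t ∈ Icc (0:ℝ) T, ∀ x y : V3, |θ t x - θ t y| ≤ C * ‖x - y‖ ^ β) :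
    ∀ t ∈ Icc (0:ℝ) T, eLpNorm (θ t) p muT = eLpNorm θin p muT := by
  intro t ht
  obtain ⟨Cv, hv⟩ := hv
  obtain ⟨Cθ, hθ⟩ := hθ
  obtain ⟨-, hθin, -, hθp, -⟩ := hdata
  have hθt : Continuous (θ t) :=
    hw.contθ.comp_continuous (Continuous.prodMk_right t) fun x => ⟨ht, mem_univ x⟩
  have hmap := hw.map_eq hT hθin.continuous hθp hβ hv hθ ht hθt
  calc eLpNorm (θ t) p muT = eLpNorm id p (muT.map (θ t)) :=
        (eLpNorm_map_measure aestronglyMeasurable_id hθt.aemeasurable).symm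
    _ = eLpNorm id p (muT.map θin) := by rw [hmap]
    _ = eLpNorm θin p muT :=
        eLpNorm_map_measure aestronglyMeasurable_id hθin.continuous.aemeasurable
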